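/- Let n ≥ 3 be an integer, let 0 < q < 1 and let x ∈ [0,1]. Then D_n^q(e_1)(x) = x. -/

import Mathlib

/-- The `q`-integer `[n]_q = 1 + q + ⋯ + q^{n-1}`. -/
noncomputable def qInt (q : ℝ) (n : ℕ) : ℝ := ∑ k ∈ Finset.range n, q ^ k

/-- The `q`-factorial `[n]_q!`. -/
noncomputable def qFact (q : ℝ) (n : ℕ) : ℝ := ∏ k ∈ Finset.range n, qInt q (k + 1)

/-- The `q`-binomial coefficient `[m choose r]_q`. -/
noncomputable def qBinom (q : ℝ) (m r : ℕ) : ℝ := qFact q m / (qFact q r * qFact q (m - r))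

/-- The Jackson `q`-integral of `g` over `[0,1]`. -/
noncomputable def qIntegral (q : ℝ) (g : ℝ → ℝ) : ℝ := (1 - q) * ∑' m : ℕ, q ^ m * g (q ^ m)

/-- The `q`-shifted factorial `(t;q)_n`. -/
noncomputable def qShift (q t : ℝ) (n : ℕ) : ℝ := ∏ j ∈ Finset.range n, (1 - t * q ^ j)

/-- The `q`-beta function `B_q(m,n)`. -/
noncomputable def qBeta (q : ℝ) (m n : ℕ) : ℝ :=
  qIntegral q (fun t => t ^ (m - 1) * qShift q (q * t) (n - 1))

/-- The weight `m_{n,k,q}(x) = (x;q)_{n+1} [n+k choose k]_q x^k`. -/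
noncomputable def mWeight (q : ℝ) (n k : ℕ) (x : ℝ) : ℝ :=
  qShift q x (n + 1) * qBinom q (n + k) k * x ^ k

/-- The `q`-MKZ–Durrmeyer operator. -/
noncomputable def Durr (q : ℝ) (n : ℕ) (f : ℝ → ℝ) (x : ℝ) : ℝ :=
  if x = 1 then f 1
  else mWeight q n 0 x * f 0 +
    ∑' k : ℕ, mWeight q n (k + 1) x * (1 / qBeta q n (k + 1)) *
      qIntegral q (fun t => t ^ k * qShift q (q * t) (n - 1) * f t)

theorem qInt_add (q : ℝ) (a b : ℕ) : qInt q (a + b) = qInt q a + q ^ a * qInt q b := by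
  simp only [qInt, Finset.sum_range_add, pow_add, Finset.mul_sum]

theorem qInt_succ_pos {q : ℝ} (hq : 0 < q) (n : ℕ) : 0 < qInt q (n + 1) :=
  Finset.sum_pos (fun _ _ => by positivity) (by simp)

theorem qFact_zero (q : ℝ) : qFact q 0 = 1 := by simp [qFact]

theorem qFact_succ (q : ℝ) (n : ℕ) : qFact q (n + 1) = qFact q n * qInt q (n + 1) :=
  Finset.prod_range_succ _ _

theorem qFact_pos {q : ℝ} (hq : 0 < q) (n : ℕ) : 0 < qFact q n :=
  Finset.prod_pos fun _ _ => qInt_succ_pos hq _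

theorem qShift_succ (q t : ℝ) (n : ℕ) : qShift q t (n + 1) = qShift q t n * (1 - t * q ^ n) :=
  Finset.prod_range_succ _ _

theorem one_sub_mul_qInt (q : ℝ) (n : ℕ) : (1 - q) * qInt q n = 1 - q ^ n :=
  mul_neg_geom_sum q n

/-- The series defining the `q`-beta integral of `t ^ a * (qt;q)_b`. -/
theorem hasSum_qBeta {q : ℝ} (hq0 : 0 < q) (hq1 : q < 1) (a b : ℕ) :
    HasSum (fun m : ℕ => q ^ m * ((q ^ m) ^ a * qShift q (q * q ^ m) b))
      (qFact q a * qFact q b / qFact q (a + b + 1) / (1 - q)) := by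
  induction b generalizing a with
  | zero =>
    have hpow : q ^ (a + 1) < 1 := pow_lt_one₀ hq0.le hq1 (by lia)
    have h := hasSum_geometric_of_lt_one (by positivity) hpow
    convert h using 1
    · funext m
      simp only [qShift, Finset.range_zero, Finset.prod_empty, mul_one]
      rw [← pow_mul, ← pow_mul, ← pow_add]
      congr 1
      ring
    · have h1 := (qFact_pos hq0 a).ne'
      have h2 := (qInt_succ_pos hq0 a).ne'
      have h3 : 1 - q ≠ 0 := by linarith
      rw [add_zero, qFact_succ, qFact_zero, ← one_sub_mul_qInt]
      field_simp
  | succ b ih =>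
    have h := (ih a).sub ((ih (a + 1)).mul_left (q ^ (b + 1)))
    convert h using 1
    · rfl
    · funext m
      rw [qShift_succ]
      ring
    · have h1 := (qInt_succ_pos hq0 (a + b + 1)).ne'
      have h2 := (qFact_pos hq0 (a + b + 1)).ne'
      have h3 : 1 - q ≠ 0 := by linarith
      have h4 := qInt_add q (b + 1) (a + 1)
      rw [show a + (b + 1) + 1 = a + b + 1 + 1 by ring,
        show a + 1 + b + 1 = a + b + 1 + 1 by ring, qFact_succ q (a + b + 1), qFact_succ q b,
        qFact_succ q a]
      rw [show b + 1 + (a + 1) = a + b + 1 + 1 by ring] at h4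
      field_simp
      rw [h4]
      ring

theorem qIntegral_pow_mul_qShift {q : ℝ} (hq0 : 0 < q) (hq1 : q < 1) (a b : ℕ) :
    qIntegral q (fun t => t ^ a * qShift q (q * t) b) =
      qFact q a * qFact q b / qFact q (a + b + 1) := by
  have h3 : 1 - q ≠ 0 := by linarith
  rw [qIntegral, (hasSum_qBeta hq0 hq1 a b).tsum_eq]
  field_simp

theorem qBinom_pos {q : ℝ} (hq : 0 < q) (m r : ℕ) : 0 < qBinom q m r :=
  div_pos (qFact_pos hq _) (mul_pos (qFact_pos hq _) (qFact_pos hq _))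

theorem qBinom_zero_right {q : ℝ} (hq : 0 < q) (m : ℕ) : qBinom q m 0 = 1 := by
  rw [qBinom, qFact_zero, one_mul, Nat.sub_zero, div_self (qFact_pos hq m).ne']

theorem qBinom_self {q : ℝ} (hq : 0 < q) (m : ℕ) : qBinom q m m = 1 := by
  rw [qBinom, Nat.sub_self, qFact_zero, mul_one, div_self (qFact_pos hq m).ne']

theorem qBinom_pascal {q : ℝ} (hq : 0 < q) (n k : ℕ) :
    qBinom q (n + 1 + (k + 1)) (k + 1) =
      qBinom q (n + (k + 1)) (k + 1) + q ^ (n + 1) * qBinom q (n + 1 + k) k := by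
  have h1 := (qFact_pos hq n).ne'
  have h2 := (qFact_pos hq k).ne'
  have h3 := (qInt_succ_pos hq n).ne'
  have h4 := (qInt_succ_pos hq k).ne'
  have h5 := qInt_add q (n + 1) (k + 1)
  simp only [qBinom, Nat.add_sub_cancel]
  rw [← add_assoc (n + 1) k 1, qFact_succ q (n + 1 + k), show n + (k + 1) = n + 1 + k by ring,
    qFact_succ q n, qFact_succ q k, show n + 1 + k + 1 = n + 1 + (k + 1) by ring, h5]
  field_simp

/-- The `q`-binomial series. -/
theorem hasSum_qBinom {q x : ℝ} (hq0 : 0 < q) (hq1 : q < 1) (hx0 : 0 ≤ x) (hx1 : x < 1) (n : ℕ) :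
    HasSum (fun k : ℕ => qBinom q (n + k) k * x ^ k) (qShift q x (n + 1))⁻¹ := by
  induction n with
  | zero =>
    simpa [qBinom_self hq0, qShift] using hasSum_geometric_of_lt_one hx0 hx1
  | succ n ih =>
    set r := x * q ^ (n + 1) with hr
    have hr0 : 0 ≤ r := by positivity
    have hr1 : r < 1 :=
      mul_lt_one_of_nonneg_of_lt_one_left hx0 hx1 (pow_le_one₀ hq0.le hq1.le)
    have hrec (k : ℕ) : qBinom q (n + 1 + (k + 1)) (k + 1) * x ^ (k + 1) =
        qBinom q (n + (k + 1)) (k + 1) * x ^ (k + 1) +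
          r * (qBinom q (n + 1 + k) k * x ^ k) := by
      rw [qBinom_pascal hq0, hr]
      ring
    have hnonneg (m k : ℕ) : 0 ≤ qBinom q (m + k) k * x ^ k :=
      mul_nonneg (qBinom_pos hq0 _ _).le (by positivity)
    set S := (qShift q x (n + 1))⁻¹ with hS
    have hbound (K : ℕ) :
        ∑ k ∈ Finset.range K, qBinom q (n + 1 + k) k * x ^ k ≤ S / (1 - r) := by
      have hS0 : 0 ≤ S := ih.nonneg (hnonneg n)
      induction K with
      | zero => simpa using div_nonneg hS0 (by linarith)
      | succ K ihK =>
        have h1 := sum_le_hasSum (Finset.range (K + 1)) (fun k _ => hnonneg n k) ih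
        rw [Finset.sum_range_succ'] at h1 ⊢
        simp only [hrec, Finset.sum_add_distrib, ← Finset.mul_sum]
        rw [qBinom_zero_right hq0] at h1 ⊢
        have h2 := mul_le_mul_of_nonneg_left ihK hr0
        have h3 : S + r * (S / (1 - r)) = S / (1 - r) := by
          have : 1 - r ≠ 0 := by linarith
          field_simp
          ring
        linarith
    have hsum := summable_of_sum_range_le (hnonneg (n + 1)) hbound
    have h := hsum.hasSum
    have h1 := ((hasSum_nat_add_iff' 1).mpr ih).add (h.mul_left r)
    simp only [← hrec] at h1
    have h2 := h1.unique ((hasSum_nat_add_iff' 1).mpr h)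
    simp only [Finset.sum_range_one, qBinom_zero_right hq0] at h2
    have h3 : ∑' k : ℕ, qBinom q (n + 1 + k) k * x ^ k = (qShift q x (n + 1 + 1))⁻¹ := by
      rw [qShift_succ, mul_inv, ← hS, ← hr, ← div_eq_mul_inv, eq_div_iff (by linarith)]
      linarith
    rwa [h3] at h

theorem qShift_pos {q x : ℝ} (hq0 : 0 < q) (hq1 : q < 1) (hx0 : 0 ≤ x) (hx1 : x < 1) (n : ℕ) :
    0 < qShift q x n :=
  Finset.prod_pos fun _ _ => sub_pos.mpr <|
    mul_lt_one_of_nonneg_of_lt_one_left hx0 hx1 (pow_le_one₀ hq0.le hq1.le)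

theorem stmt4 (q : ℝ) (hq0 : 0 < q) (hq1 : q < 1) (n : ℕ) (hn : 3 ≤ n)
    (x : ℝ) (hx : x ∈ Set.Icc (0 : ℝ) 1) :
    Durr q n (fun t => t) x = x := by
  rw [Durr]
  split_ifs with h
  · exact h.symm
  have hx1 : x < 1 := lt_of_le_of_ne hx.2 h
  obtain ⟨N, rfl⟩ : ∃ N, n = N + 1 := ⟨n - 1, by lia⟩
  have hterm (k : ℕ) : mWeight q (N + 1) (k + 1) x * (1 / qBeta q (N + 1) (k + 1)) *
      qIntegral q (fun t => t ^ k * qShift q (q * t) (N + 1 - 1) * t) =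
      x * qShift q x (N + 1 + 1) * (qBinom q (N + 1 + k) k * x ^ k) := by
    have hint : (fun t : ℝ => t ^ k * qShift q (q * t) (N + 1 - 1) * t) =
        fun t => t ^ (k + 1) * qShift q (q * t) N := by
      funext t
      rw [Nat.add_sub_cancel]
      ring
    rw [hint, qIntegral_pow_mul_qShift hq0 hq1, qBeta, qIntegral_pow_mul_qShift hq0 hq1]
    simp only [mWeight, qBinom, Nat.add_sub_cancel]
    rw [show k + 1 + N + 1 = N + 1 + (k + 1) by ring, show N + k + 1 = N + 1 + k by ring,
      qFact_succ q k]
    have h1 := (qFact_pos hq0 N).ne'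
    have h2 := (qFact_pos hq0 k).ne'
    have h3 := (qInt_succ_pos hq0 k).ne'
    have h4 := (qFact_pos hq0 (N + 1)).ne'
    have h5 := (qFact_pos hq0 (N + 1 + k)).ne'
    have h6 := (qFact_pos hq0 (N + 1 + (k + 1))).ne'
    field_simp
    ring
  simp only [hterm, mul_zero, zero_add]
  rw [tsum_mul_left, (hasSum_qBinom hq0 hq1 hx.1 hx1 (N + 1)).tsum_eq,
    mul_inv_cancel_right₀ (qShift_pos hq0 hq1 hx.1 hx1 _).ne']
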